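/- arXiv:1503.04383 — 2 statements merged into one kernel-verified Lean document; each statement's English description precedes it below -/
import Mathlib

section
/- Let X be a Polish topological space, let d be a compatible metric on X, and let (X̃, d̃) be the completion of (X, d). Then the image of CL(X) under the map A ↦ closure of A in X̃ is a G_δ subset of the hyperspace CL(X̃) equipped with the Hausdorff metric topology τ_{H_{d̃}}. -/
open TopologicalSpace

/-- `CL X` is the hyperspace of nonempty closed subsets of `X`, equipped (via the instance
below) with the Hausdorff extended metric, and hence with the Hausdorff metric topology. -/
def CL (X : Type*) [EMetricSpace X] : Type _ :=
  {s : TopologicalSpace.Closeds X // (s : Set X).Nonempty}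

/-- The Hausdorff extended metric on the hyperspace of nonempty closed sets:
`edist A B` is the Hausdorff extended distance `hausdorffEdist (A : Set X) (B : Set X)`. -/
noncomputable instance CL.instEMetricSpace (X : Type*) [EMetricSpace X] :
    EMetricSpace (CL X) :=
  inferInstanceAs (EMetricSpace {s : TopologicalSpace.Closeds X // (s : Set X).Nonempty})

/-- A topological space is completely metrizable if some complete metric induces its topology. -/
def IsCompletelyMetrizable (Z : Type*) [t : TopologicalSpace Z] : Prop :=
  ∃ m : MetricSpace Z, m.toUniformSpace.toTopologicalSpace = t ∧ @CompleteSpace Z m.toUniformSpace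

/-- The map sending a nonempty closed subset `A` of `X` to the closure of (the image of) `A`
in the completion `X̃` of `X`, viewed as a map between hyperspaces. -/
noncomputable def closureInCompletion (X : Type*) [MetricSpace X] (A : CL X) :
    CL (UniformSpace.Completion X) :=
  ⟨⟨closure (((↑) : X → UniformSpace.Completion X) '' (A.1 : Set X)), isClosed_closure⟩,
    (A.2.image _).closure⟩

open Set Filter Topology

/-- A completely metrizable dense subspace of a Hausdorff space is a `Gδ` set. -/
theorem Topology.IsDenseInducing.isGδ_range {X Y : Type*} [TopologicalSpace X]
    [TopologicalSpace.IsCompletelyPseudoMetrizableSpace X] [TopologicalSpace Y] [T2Space Y]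
    {f : X → Y} (hf : IsDenseInducing f) : IsGδ (range f) := by
  let := upgradeIsCompletelyPseudoMetrizable X
  let U : ℕ → Set Y := fun n =>
    ⋃₀ {W | IsOpen W ∧ ∀ x y, f x ∈ W → f y ∈ W → dist x y < 1 / ((n : ℝ) + 1)}
  have hU : range f = ⋂ n, U n := by
    refine Subset.antisymm ?_ fun z hz => ?_
    · rintro _ ⟨x, rfl⟩
      refine mem_iInter.2 fun n => ?_
      have hn : (0 : ℝ) < 1 / ((n : ℝ) + 1) := Nat.one_div_pos_of_nat
      obtain ⟨W, hW, hWx⟩ := hf.isInducing.isOpen_iff.1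
        (Metric.isOpen_ball (x := x) (ε := 1 / ((n : ℝ) + 1) / 2))
      have hmem : ∀ y, f y ∈ W ↔ dist y x < 1 / ((n : ℝ) + 1) / 2 := fun y => by
        rw [← Metric.mem_ball, ← hWx, mem_preimage]
      refine ⟨W, ⟨hW, fun a b ha hb => ?_⟩, (hmem x).2 (by rw [dist_self]; positivity)⟩
      have := dist_triangle_right a b x
      linarith [(hmem a).1 ha, (hmem b).1 hb]
    · have : (comap f (𝓝 z)).NeBot := hf.comap_nhds_neBot z
      have hc : Cauchy (comap f (𝓝 z)) := by
        refine Metric.cauchy_iff.2 ⟨this, fun ε hε => ?_⟩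
        obtain ⟨n, hn⟩ := exists_nat_one_div_lt hε
        obtain ⟨W, ⟨hW, hd⟩, hzW⟩ := mem_iInter.1 hz n
        exact ⟨f ⁻¹' W, preimage_mem_comap (hW.mem_nhds hzW),
          fun x hx y hy => (hd x y hx hy).trans hn⟩
      obtain ⟨x, hx⟩ := CompleteSpace.complete hc
      exact ⟨x, tendsto_nhds_unique (hf.continuous.continuousAt.tendsto.mono_left hx)
        tendsto_comap⟩
  rw [hU]
  exact .iInter_of_isOpen fun n => isOpen_sUnion fun W hW => hW.1

/-- The Baire category theorem relative to a closed subset of a complete space. -/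
theorem IsClosed.subset_closure_inter_iInter {Y : Type*} [MetricSpace Y] [CompleteSpace Y]
    {F : Set Y} (hF : IsClosed F) {U : ℕ → Set Y} (hU : ∀ n, IsOpen (U n))
    (h : ∀ n, F ⊆ closure (F ∩ U n)) : F ⊆ closure (F ∩ ⋂ n, U n) := by
  have := hF.completeSpace_coe
  have hd : Dense (⋂ n, ((↑) : F → Y) ⁻¹' U n) :=
    dense_iInter_of_isOpen_nat (fun n => (hU n).preimage continuous_subtype_val) fun n => by
      rw [Subtype.dense_iff, Subtype.image_preimage_coe]
      exact h n
  rwa [← preimage_iInter, Subtype.dense_iff, Subtype.image_preimage_coe] at hd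

theorem TopologicalSpace.IsTopologicalBasis.subset_closure_inter_iff {Y : Type*}
    [TopologicalSpace Y] {B : Set (Set Y)} (hB : IsTopologicalBasis B) {F U : Set Y} :
    F ⊆ closure (F ∩ U) ↔ ∀ V ∈ B, (F ∩ V).Nonempty → (F ∩ (V ∩ U)).Nonempty := by
  constructor
  · rintro h V hV ⟨x, hxF, hxV⟩
    obtain ⟨y, hyV, hyF, hyU⟩ := hB.mem_closure_iff.1 (h hxF) V hV hxV
    exact ⟨y, hyF, hyV, hyU⟩
  · refine fun h x hx => hB.mem_closure_iff.2 fun V hV hxV => ?_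
    obtain ⟨y, hyF, hyV, hyU⟩ := h V hV ⟨x, hx, hxV⟩
    exact ⟨y, hyV, hyF, hyU⟩

theorem CL.isOpen_inter_nonempty {Y : Type*} [EMetricSpace Y] {V : Set Y} (hV : IsOpen V) :
    IsOpen {F : CL Y | ((F.1 : Set Y) ∩ V).Nonempty} :=
  (Closeds.isOpen_inter_nonempty_of_isOpen hV).preimage continuous_subtype_val

/-- For a `Gδ` subset `S` of a complete separable space, the nonempty closed sets in which `S` is
dense form a `Gδ` subset of the hyperspace. -/
theorem CL.isGδ_setOf_subset_closure_inter {Y : Type*} [MetricSpace Y] [CompleteSpace Y]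
    [SeparableSpace Y] {S : Set Y} (hS : IsGδ S) :
    IsGδ {F : CL Y | (F.1 : Set Y) ⊆ closure (F.1 ∩ S)} := by
  have := UniformSpace.secondCountable_of_separable Y
  obtain ⟨U, hU, rfl⟩ := hS.eq_iInter_nat
  have heq : {F : CL Y | (F.1 : Set Y) ⊆ closure (F.1 ∩ ⋂ n, U n)} =
      ⋂ n, ⋂ V ∈ countableBasis Y, ({F : CL Y | ((F.1 : Set Y) ∩ V).Nonempty}ᶜ ∪
        {F : CL Y | ((F.1 : Set Y) ∩ (V ∩ U n)).Nonempty}) := by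
    ext F
    simp only [mem_iInter, mem_union, mem_compl_iff, mem_ofPred_eq, ← imp_iff_not_or]
    simp_rw [← (isBasis_countableBasis Y).subset_closure_inter_iff]
    exact ⟨fun h n => h.trans (closure_mono (inter_subset_inter_right _ (iInter_subset U n))),
      F.1.isClosed.subset_closure_inter_iInter hU⟩
  rw [heq]
  refine .iInter fun n => .biInter (countable_countableBasis Y) fun V hV => .union ?_ ?_
  · exact (isOpen_inter_nonempty (isOpen_of_mem_countableBasis hV)).isClosed_compl.isGδ
  · exact (isOpen_inter_nonempty ((isOpen_of_mem_countableBasis hV).inter (hU n))).isGδ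

theorem range_closureInCompletion (X : Type*) [MetricSpace X] :
    range (closureInCompletion X) =
      {F | (F.1 : Set (UniformSpace.Completion X)) ⊆
        closure (F.1 ∩ range ((↑) : X → UniformSpace.Completion X))} := by
  refine Subset.antisymm ?_ fun F hF => ?_
  · rintro _ ⟨A, rfl⟩
    exact closure_mono (subset_inter subset_closure (image_subset_range _ _))
  · have himage : closure (((↑) : X → UniformSpace.Completion X) '' ((↑) ⁻¹'
        (F.1 : Set (UniformSpace.Completion X)))) = F.1 := by
      rw [image_preimage_eq_inter_range]
      exact (closure_minimal inter_subset_left F.1.isClosed).antisymm hF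
    refine ⟨⟨⟨_, F.1.isClosed.preimage (UniformSpace.Completion.continuous_coe X)⟩, ?_⟩,
      Subtype.ext (Closeds.ext himage)⟩
    have := F.2
    rw [← himage] at this
    exact this.of_closure.of_image

/-- If `X` is Polish and `d` a compatible metric (i.e. `X` is a metric space whose topology is
Polish), then the image of `CL(X)` under `A ↦ closure of A in X̃` is a `Gδ` subset of the
hyperspace `CL(X̃)` with the Hausdorff metric topology. -/
theorem stmt3 (X : Type*) [MetricSpace X] [PolishSpace X] :
    IsGδ (Set.range (closureInCompletion X)) := by
  rw [range_closureInCompletion]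
  exact CL.isGδ_setOf_subset_closure_inter
    UniformSpace.Completion.isDenseInducing_coe.isGδ_range
end

section
/- There exists a completely metrizable topological space X together with two bounded metrics d and d', both compatible with the topology of X, such that the hyperspace CL(X) equipped with the topology induced by the Hausdorff metric H_d is completely metrizable, while CL(X) equipped with the topology induced by the Hausdorff metric H_{d'} is not completely metrizable. -/
open TopologicalSpace

/-- The metric taking the value `1` on each pair of distinct points. -/
noncomputable abbrev zeroOneMetric (Z : Type*) : MetricSpace Z :=
  open Classical in
  { dist := fun x y => if x = y then 0 else 1
    dist_self := by simp
    dist_comm := by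
      intro x y
      by_cases h : x = y
      · rw [h]
      · rw [if_neg h, if_neg (Ne.symm h)]
    dist_triangle := by
      intro x y z
      by_cases hxy : x = y <;> by_cases hyz : y = z <;> by_cases hxz : x = z <;>
        simp_all
    eq_of_dist_eq_zero := by
      intro x y h
      by_contra hne
      simp [hne] at h }

theorem zeroOneMetric_one_le_dist {Z : Type*} {x y : Z} (h : x ≠ y) :
    1 ≤ (zeroOneMetric Z).dist x y := by
  classical
  change (1 : ℝ) ≤ if x = y then 0 else 1
  simp [h]

theorem zeroOneMetric_discreteTopology (Z : Type*) :
    @DiscreteTopology Z (zeroOneMetric Z).toUniformSpace.toTopologicalSpace :=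
  let := zeroOneMetric Z
  .of_forall_le_dist one_pos fun _ _ h => zeroOneMetric_one_le_dist h

theorem zeroOneMetric_completeSpace (Z : Type*) :
    @CompleteSpace Z (zeroOneMetric Z).toUniformSpace := by
  let := zeroOneMetric Z
  refine Metric.complete_of_cauchySeq_tendsto fun u hu => ?_
  obtain ⟨N, hN⟩ := Metric.cauchySeq_iff'.1 hu 1 one_pos
  refine ⟨u N, tendsto_const_nhds.congr' ?_⟩
  filter_upwards [Filter.eventually_ge_atTop N] with n hn
  by_contra h
  exact absurd (hN n hn) (not_lt.2 (zeroOneMetric_one_le_dist (Ne.symm h)))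

theorem DiscreteTopology.isCompletelyMetrizable (Z : Type*) [TopologicalSpace Z]
    [h : DiscreteTopology Z] : IsCompletelyMetrizable Z :=
  ⟨zeroOneMetric Z, (zeroOneMetric_discreteTopology Z).eq_bot.trans h.eq_bot.symm,
    zeroOneMetric_completeSpace Z⟩

theorem CL.edist_eq {X : Type*} [EMetricSpace X] (A B : CL X) :
    edist A B = Metric.hausdorffEDist (A.1 : Set X) (B.1 : Set X) := rfl

/-- If distinct points of `X` are at distance at least `1`, so are distinct closed sets. -/
theorem CL.discreteTopology {X : Type*} [EMetricSpace X]
    (h : ∀ x y : X, x ≠ y → 1 ≤ edist x y) : DiscreteTopology (CL X) := by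
  have key : ∀ A B : CL X, edist A B < 1 → (A.1 : Set X) ⊆ B.1 := by
    intro A B hAB x hx
    obtain ⟨y, hy, hxy⟩ := Metric.exists_edist_lt_of_hausdorffEDist_lt hx hAB
    by_contra hxB
    exact absurd hxy (not_lt.2 (h x y fun e => hxB (e ▸ hy)))
  refine discreteTopology_iff_isOpen_singleton.2 fun A => ?_
  convert Metric.isOpen_eball (x := A) (ε := 1) using 1
  ext B
  refine ⟨fun hB => ?_, fun hB => ?_⟩
  · rw [Set.mem_singleton_iff.1 hB]
    exact Metric.mem_eball_self one_pos
  · have hBA : edist B A < 1 := hB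
    exact Subtype.ext (Closeds.ext
      ((key B A hBA).antisymm (key A B (by rwa [edist_comm]))))

/-- The disjoint union, indexed by the functions `ℕ → ℕ`, of copies of `ℕ`. -/
@[ext]
structure Comb where
  /-- The index of the copy of `ℕ`. -/
  base : ℕ → ℕ
  /-- The element of `ℕ`. -/
  height : ℕ

/-- The metric on `Comb` for which distinct copies of `ℕ` are at distance `1` and distinct
elements `k`, `l` of one copy are at distance `max (1 / (k + 1)) (1 / (l + 1))`. -/
noncomputable abbrev Comb.metric : MetricSpace Comb :=
  open Classical in
  { dist := fun p q => if p = q then 0 else if p.base = q.base then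
      max (1 / ((p.height : ℝ) + 1)) (1 / ((q.height : ℝ) + 1)) else 1
    dist_self := by simp
    dist_comm := by
      intro p q
      by_cases h : p = q
      · rw [h]
      rw [if_neg h, if_neg (Ne.symm h), max_comm]
      by_cases hb : p.base = q.base
      · rw [if_pos hb, if_pos hb.symm]
      · rw [if_neg hb, if_neg (Ne.symm hb)]
    dist_triangle := by
      intro p q r
      have hb : ∀ s : Comb, 0 < 1 / ((s.height : ℝ) + 1) ∧ 1 / ((s.height : ℝ) + 1) ≤ 1 :=
        fun s => ⟨by positivity, (div_le_one (by positivity)).2 (by simp)⟩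
      by_cases hpq : p = q
      · subst hpq
        simp
      by_cases hqr : q = r
      · subst hqr
        simp
      obtain ⟨hp, hp'⟩ := hb p
      obtain ⟨hq, hq'⟩ := hb q
      obtain ⟨hr, hr'⟩ := hb r
      generalize 1 / ((p.height : ℝ) + 1) = a at *
      generalize 1 / ((q.height : ℝ) + 1) = b at *
      generalize 1 / ((r.height : ℝ) + 1) = c at *
      split_ifs <;> grind
    eq_of_dist_eq_zero := by
      intro p q h
      by_contra hne
      have hp : 0 < 1 / ((p.height : ℝ) + 1) := by positivity
      simp only [hne, if_false] at h
      split_ifs at h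
      · exact absurd h (lt_max_of_lt_left hp).ne'
      · exact one_ne_zero h }

namespace Comb

attribute [local instance] Comb.metric

theorem dist_of_base_ne {p q : Comb} (h : p.base ≠ q.base) : dist p q = 1 := by
  classical
  change (if p = q then (0 : ℝ) else if p.base = q.base then
      max (1 / ((p.height : ℝ) + 1)) (1 / ((q.height : ℝ) + 1)) else 1) = 1
  rw [if_neg (fun e => h (congrArg base e)), if_neg h]

theorem dist_of_base_eq {p q : Comb} (h : p.base = q.base) (hne : p ≠ q) :
    dist p q = max (1 / ((p.height : ℝ) + 1)) (1 / ((q.height : ℝ) + 1)) := by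
  classical
  change (if p = q then (0 : ℝ) else if p.base = q.base then
      max (1 / ((p.height : ℝ) + 1)) (1 / ((q.height : ℝ) + 1)) else 1) = _
  rw [if_neg hne, if_pos h]

theorem one_div_height_add_one_le_one (p : Comb) : 1 / ((p.height : ℝ) + 1) ≤ 1 :=
  (div_le_one (by positivity)).2 (by simp)

theorem dist_le_one (p q : Comb) : dist p q ≤ 1 := by
  by_cases hpq : p = q
  · simp [hpq]
  by_cases h : p.base = q.base
  · rw [dist_of_base_eq h hpq]
    exact max_le p.one_div_height_add_one_le_one q.one_div_height_add_one_le_one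
  · exact (dist_of_base_ne h).le

theorem one_div_le_dist {p q : Comb} (h : p ≠ q) : 1 / ((p.height : ℝ) + 1) ≤ dist p q := by
  by_cases hb : p.base = q.base
  · exact (le_max_left _ _).trans_eq (dist_of_base_eq hb h).symm
  · exact p.one_div_height_add_one_le_one.trans_eq (dist_of_base_ne hb).symm

instance : DiscreteTopology Comb := by
  refine discreteTopology_iff_isOpen_singleton.2 fun p => ?_
  rw [Metric.isOpen_singleton_iff]
  refine ⟨1 / ((p.height : ℝ) + 1), by positivity, fun q hq => ?_⟩
  by_contra hne
  rw [dist_comm] at hq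
  exact absurd hq (not_lt.2 (one_div_le_dist (Ne.symm hne)))

/-- The graph of a function choosing one element in each copy of `ℕ`. -/
def graph (f : (ℕ → ℕ) → ℕ) : CL Comb :=
  ⟨⟨{p | p.height = f p.base}, isClosed_discrete _⟩, ⟨⟨0, f 0⟩, rfl⟩⟩

theorem edist_graph_le {f g : (ℕ → ℕ) → ℕ} {N : ℕ}
    (h : ∀ a, f a ≠ g a → N ≤ f a ∧ N ≤ g a) :
    edist (graph f) (graph g) ≤ ENNReal.ofReal (1 / ((N : ℝ) + 1)) := by
  have key : ∀ f g : (ℕ → ℕ) → ℕ, (∀ a, f a ≠ g a → N ≤ f a ∧ N ≤ g a) →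
      ∀ p ∈ ((graph f).1 : Set Comb), ∃ q ∈ ((graph g).1 : Set Comb),
        edist p q ≤ ENNReal.ofReal (1 / ((N : ℝ) + 1)) := by
    intro f g h p hp
    have hp : p.height = f p.base := hp
    refine ⟨⟨p.base, g p.base⟩, rfl, ?_⟩
    rw [edist_dist]
    refine ENNReal.ofReal_le_ofReal ?_
    by_cases hpg : f p.base = g p.base
    · have hpeq : p = ⟨p.base, g p.base⟩ := Comb.ext rfl (hp.trans hpg)
      rw [← hpeq]
      simp only [dist_self]
      positivity
    · have hne : p ≠ ⟨p.base, g p.base⟩ := fun e => hpg (hp.symm.trans (congrArg height e))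
      obtain ⟨h₁, h₂⟩ := h _ hpg
      rw [dist_of_base_eq (p := p) (q := ⟨p.base, g p.base⟩) rfl hne, hp]
      refine max_le ?_ ?_ <;> exact one_div_le_one_div_of_le (by positivity) (by simpa)
  rw [CL.edist_eq]
  exact Metric.hausdorffEDist_le_of_mem_edist (key f g h)
    (key g f fun a ha => (h a ha.symm).symm)

/-- Graphs of functions differing from `f` only where both values are large belong to a given
neighborhood of the graph of `f`. -/
theorem exists_forall_graph_mem {f : (ℕ → ℕ) → ℕ} {s : Set (CL Comb)} (n : ℕ)
    (hs : s ∈ nhds (graph f)) :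
    ∃ N : ℕ, n ≤ N ∧ ∀ g : (ℕ → ℕ) → ℕ,
      (∀ a, f a ≠ g a → N ≤ f a ∧ N ≤ g a) → graph g ∈ s := by
  obtain ⟨ε, hε, hεs⟩ := EMetric.mem_nhds_iff.1 hs
  have h0 : Filter.Tendsto (fun N : ℕ => ENNReal.ofReal (1 / ((N : ℝ) + 1)))
      Filter.atTop (nhds 0) := by
    simpa using ENNReal.tendsto_ofReal tendsto_one_div_add_atTop_nhds_zero_nat
  obtain ⟨N, hN, hnN⟩ :=
    ((h0.eventually (gt_mem_nhds hε)).and (Filter.eventually_ge_atTop n)).exists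
  refine ⟨N, hnN, fun g hg => hεs ?_⟩
  rw [Metric.mem_eball, edist_comm]
  exact (edist_graph_le hg).trans_lt hN

/-- A sequence of graphs converging in the hyperspace has no value tending to infinity. -/
theorem not_tendsto_graph {f : ℕ → (ℕ → ℕ) → ℕ} {a : ℕ → ℕ}
    (ha : Filter.Tendsto (fun n => f n a) Filter.atTop Filter.atTop) (A : CL Comb) :
    ¬ Filter.Tendsto (fun n => graph (f n)) Filter.atTop (nhds A) := by
  intro hA
  have h0 := tendsto_iff_edist_tendsto_0.1 hA
  obtain ⟨n, hn⟩ := (h0.eventually (gt_mem_nhds one_pos)).exists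
  obtain ⟨p, hpA, hp⟩ := Metric.exists_edist_lt_of_hausdorffEDist_lt
    (x := (⟨a, f n a⟩ : Comb)) (s := ((graph (f n)).1 : Set Comb)) rfl hn
  have hpa : p.base = a := by
    by_contra hne
    rw [edist_dist, dist_of_base_ne (Ne.symm hne)] at hp
    simp at hp
  have hpos : (0 : ENNReal) < ENNReal.ofReal (1 / ((p.height : ℝ) + 1)) :=
    ENNReal.ofReal_pos.2 (by positivity)
  obtain ⟨k, hk, hkp⟩ :=
    ((h0.eventually (gt_mem_nhds hpos)).and (ha.eventually_gt_atTop p.height)).exists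
  rw [edist_comm] at hk
  obtain ⟨q, hq, hpq⟩ := Metric.exists_edist_lt_of_hausdorffEDist_lt hpA hk
  have hq : q.height = f k q.base := hq
  rw [edist_dist] at hpq
  have hlt := (ENNReal.ofReal_lt_ofReal_iff (by positivity)).1 hpq
  have hpq' : p = q := by
    by_contra hne
    exact absurd hlt (not_lt.2 (one_div_le_dist hne))
  rw [← hpq', hpa] at hq
  omega

/-- Given moduli `N n f`, the sequence of functions whose `n + 1`-st term modifies the `n`-th
term `f` only at places where `f` takes values at least `N n f`. -/
def modify (N : ℕ → ((ℕ → ℕ) → ℕ) → ℕ) : ℕ → (ℕ → ℕ) → ℕ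
  | 0 => fun a => a 0
  | n + 1 => fun a =>
    if modify N n a < N n (modify N n) then modify N n a
    else N n (modify N n) + a (n + 1)

theorem le_modify (N : ℕ → ((ℕ → ℕ) → ℕ) → ℕ) (n : ℕ) :
    N n (modify N n) ≤ modify N n fun k => N k (modify N k) := by
  induction n with
  | zero => exact le_rfl
  | succ n ih =>
    conv_rhs => rw [modify]
    beta_reduce
    rw [if_neg (not_lt.2 ih)]
    exact Nat.le_add_left _ _

theorem not_isCompletelyMetrizable_CL : ¬ IsCompletelyMetrizable (CL Comb) := by
  rintro ⟨m, hm, hc⟩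
  have hN : ∀ (n : ℕ) (f : (ℕ → ℕ) → ℕ), ∃ N : ℕ, n ≤ N ∧ ∀ g : (ℕ → ℕ) → ℕ,
      (∀ a, f a ≠ g a → N ≤ f a ∧ N ≤ g a) →
        graph g ∈ @Metric.ball _ m.toPseudoMetricSpace (graph f) (1 * (1 / 2) ^ n) :=
    fun n f => exists_forall_graph_mem n
      (hm ▸ @Metric.ball_mem_nhds _ m.toPseudoMetricSpace (graph f) _ (by positivity))
  choose N hnN hN using hN
  have hcauchy : @CauchySeq _ _ m.toUniformSpace _ fun n => graph (modify N n) := by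
    refine @cauchySeq_of_le_geometric _ m.toPseudoMetricSpace (1 / 2) 1
      (fun n => graph (modify N n)) (by norm_num) fun n => ?_
    refine (@Metric.mem_ball' _ m.toPseudoMetricSpace _ _ _).1 (hN n _ _ fun a ha => ?_) |>.le
    rw [modify] at ha ⊢
    beta_reduce at ha ⊢
    split_ifs at ha ⊢ with h
    · exact absurd rfl ha
    · exact ⟨not_lt.1 h, Nat.le_add_right _ _⟩
  obtain ⟨A, hA⟩ := @cauchySeq_tendsto_of_complete _ _ m.toUniformSpace _ hc _ hcauchy
  rw [hm] at hA
  refine not_tendsto_graph (a := fun k => N k (modify N k)) ?_ A hA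
  exact Filter.tendsto_atTop_mono (fun n => (hnN n _).trans (le_modify N n)) Filter.tendsto_id

end Comb

/-- There is a completely metrizable topological space `X` with two compatible bounded metrics
`d` and `d'` such that `CL(X)` with the Hausdorff metric topology of `H_d` is completely
metrizable, while `CL(X)` with the Hausdorff metric topology of `H_{d'}` is not. -/
theorem stmt12 :
    ∃ (X : Type) (m m' : MetricSpace X),
      -- `d` and `d'` are compatible with one and the same topology on `X`
      m.toUniformSpace.toTopologicalSpace = m'.toUniformSpace.toTopologicalSpace ∧
      -- that topology is completely metrizable
      (letI := m; IsCompletelyMetrizable X) ∧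
      -- both metrics are bounded
      (letI := m; ∃ C : ℝ, ∀ x y : X, dist x y ≤ C) ∧
      (letI := m'; ∃ C : ℝ, ∀ x y : X, dist x y ≤ C) ∧
      -- `(CL(X), τ_{H_d})` is completely metrizable
      (letI := m; IsCompletelyMetrizable (CL X)) ∧
      -- `(CL(X), τ_{H_{d'}})` is not completely metrizable
      (letI := m'; ¬ IsCompletelyMetrizable (CL X)) := by
  refine ⟨Comb, zeroOneMetric Comb, Comb.metric, ?_, ?_, ⟨1, fun x y => ?_⟩,
    ⟨1, Comb.dist_le_one⟩, ?_, Comb.not_isCompletelyMetrizable_CL⟩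
  · exact (zeroOneMetric_discreteTopology Comb).eq_bot.trans
      Comb.instDiscreteTopology.eq_bot.symm
  · exact ⟨zeroOneMetric Comb, rfl, zeroOneMetric_completeSpace Comb⟩
  · classical
    change (if x = y then (0 : ℝ) else 1) ≤ 1
    split_ifs <;> norm_num
  · let := zeroOneMetric Comb
    have : DiscreteTopology (CL Comb) := CL.discreteTopology fun x y h => by
      rw [edist_dist, ← ENNReal.ofReal_one]
      exact ENNReal.ofReal_le_ofReal (zeroOneMetric_one_le_dist h)
    exact DiscreteTopology.isCompletelyMetrizable (CL Comb)
end
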